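/- arXiv:1507.01873 — 10 statements merged into one kernel-verified Lean document; each statement's English description precedes it below -/
import Mathlib

section
/- Let σ be a conductance matrix on n ≥ 2 nodes, let V : Fin n → ℝ, and let m be an interior node (m ≠ 0 and m ≠ n-1) at which the junction rule holds, i.e. ∑_{j} σ m j * (V m - V j) = 0. If V attains its maximum at m (V j ≤ V m for all j), then every neighbor of m attains the same value: for every j with σ m j > 0, V j = V m. -/
open Matrix BigOperators

/-- A conductance matrix: symmetric, nonnegative entries, zero diagonal. -/
def IsConductance {N : ℕ} (σ : Matrix (Fin N) (Fin N) ℝ) : Prop :=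
  (∀ i j, σ i j = σ j i) ∧ (∀ i j, 0 ≤ σ i j) ∧ (∀ i, σ i i = 0)

/-- The weighted Laplacian of a conductance matrix. -/
def lap {N : ℕ} (σ : Matrix (Fin N) (Fin N) ℝ) : Matrix (Fin N) (Fin N) ℝ :=
  Matrix.of fun i j => if i = j then ∑ k, σ i k else -σ i j

/-- Σ'(σ): the Laplacian with the row and column of the last node deleted. -/
def sigmaP {n : ℕ} (σ : Matrix (Fin (n+2)) (Fin (n+2)) ℝ) :
    Matrix (Fin (n+1)) (Fin (n+1)) ℝ :=
  (lap σ).submatrix Fin.castSucc Fin.castSucc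

/-- Σ''(σ): the Laplacian with the rows and columns of the first and last nodes deleted. -/
def sigmaPP {n : ℕ} (σ : Matrix (Fin (n+2)) (Fin (n+2)) ℝ) :
    Matrix (Fin n) (Fin n) ℝ :=
  (lap σ).submatrix (fun i => i.succ.castSucc) (fun i => i.succ.castSucc)

/-- The junction rules: total current out of each interior node vanishes. -/
def Junction {n : ℕ} (σ : Matrix (Fin (n+2)) (Fin (n+2)) ℝ) (V : Fin (n+2) → ℝ) : Prop :=
  ∀ i : Fin (n+2), i ≠ 0 → i ≠ Fin.last (n+1) → ∑ j, σ i j * (V i - V j) = 0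

/-- If the junction rule holds at an interior node `m` where the potential attains its
maximum, then every neighbor of `m` has the same potential. -/
theorem neighbors_of_max_eq {n : ℕ} (σ : Matrix (Fin (n+2)) (Fin (n+2)) ℝ)
    (hσ : IsConductance σ) (V : Fin (n+2) → ℝ)
    (m : Fin (n+2)) (hm0 : m ≠ 0) (hmn : m ≠ Fin.last (n+1))
    (hj : ∑ j, σ m j * (V m - V j) = 0)
    (hmax : ∀ j, V j ≤ V m) :
    ∀ j, 0 < σ m j → V j = V m := by
  intro j hpos
  have hnonneg : ∀ k ∈ Finset.univ, 0 ≤ σ m k * (V m - V k) := fun k _ =>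
    mul_nonneg (hσ.2.1 m k) (sub_nonneg.2 (hmax k))
  have hzero := (Finset.sum_eq_zero_iff_of_nonneg hnonneg).1 hj j (Finset.mem_univ j)
  exact (sub_eq_zero.1 ((mul_eq_zero.1 hzero).resolve_left hpos.ne')).symm
end

section
/- Let σ be a conductance matrix on n ≥ 2 nodes whose associated graph remains connected after deleting node 0 and also remains connected after deleting node n-1. Let ℰ > 0 and let V : Fin n → ℝ satisfy the junction rules for σ with V 0 = ℰ and V (n-1) = 0. Then every interior nodal potential lies strictly between the battery voltages: for every i with i ≠ 0 and i ≠ n-1, 0 < V i < ℰ. -/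
open Matrix BigOperators

/-- Where a weighted graph is balanced at a maximum of `V`, every neighbour attains the maximum. -/
theorem eq_of_sum_mul_sub_eq_zero {ι : Type*} [Fintype ι] {w V : ι → ℝ} {i j : ι}
    (hw : ∀ k, 0 ≤ w k) (hmax : ∀ k, V k ≤ V i) (hsum : ∑ k, w k * (V i - V k) = 0)
    (hj : 0 < w j) : V j = V i := by
  have hterm := (Finset.sum_eq_zero_iff_of_nonneg fun k _ =>
    mul_nonneg (hw k) (sub_nonneg.2 (hmax k))).1 hsum j (Finset.mem_univ j)
  have := (mul_eq_zero.1 hterm).resolve_left hj.ne'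
  linarith

/-- Strong maximum principle: a potential balanced away from `a` and `b`, with `V b < V a`, stays
strictly below `V a` off `a`, provided the graph without `a` is connected. -/
theorem lt_of_balanced_of_connected {ι : Type*} [Fintype ι] {σ : Matrix ι ι ℝ}
    (hsymm : ∀ i j, σ i j = σ j i) (hnonneg : ∀ i j, 0 ≤ σ i j) {V : ι → ℝ} {a b : ι}
    (hbal : ∀ i, i ≠ a → i ≠ b → ∑ j, σ i j * (V i - V j) = 0) (hba : V b < V a)
    (hconn : ((SimpleGraph.fromRel fun i j => 0 < σ i j).induce {i | i ≠ a}).Connected)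
    {i : ι} (hi : i ≠ a) : V i < V a := by
  classical
  by_contra! hle
  obtain ⟨m, hm, hmax⟩ := (Finset.univ.erase a).exists_max_image V ⟨i, by simp [hi]⟩
  have hma : m ≠ a := Finset.ne_of_mem_erase hm
  have ham : V a ≤ V m := hle.trans (hmax i (by simp [hi]))
  have hmax' : ∀ k, V k ≤ V m := fun k => by
    by_cases hk : k = a
    · exact hk ▸ ham
    · exact hmax k (by simp [hk])
  have hb : b ≠ a := fun h => hba.ne (congrArg V h)
  have hreach := (SimpleGraph.reachable_iff_reflTransGen _ _).1
    (hconn.preconnected ⟨m, hma⟩ ⟨b, hb⟩)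
  have hconst : V b = V m := by
    refine hreach.head_induction_on (motive := fun u _ => V u.1 = V m → V b = V m)
      id (fun {u v} huv _ ih hu => ih ?_) rfl
    have hpos : 0 < σ u v := by
      rcases ((SimpleGraph.fromRel_adj _ _ _).1 (SimpleGraph.induce_adj.1 huv)).2 with h | h
      · exact h
      · exact (hsymm u v).symm ▸ h
    have hub : (u : ι) ≠ b := fun h => by rw [h] at hu; linarith
    rw [← hu]
    exact eq_of_sum_mul_sub_eq_zero (hnonneg u) (fun k => hu ▸ hmax' k)
      (hbal u u.2 hub) hpos
  linarith

/-- All interior nodal potentials lie strictly between the battery voltages. -/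
theorem potentials_strictly_between {n : ℕ} (σ : Matrix (Fin (n+2)) (Fin (n+2)) ℝ)
    (hσ : IsConductance σ)
    (hc0 : ((SimpleGraph.fromRel fun i j => 0 < σ i j).induce
      {i : Fin (n+2) | i ≠ 0}).Connected)
    (hcn : ((SimpleGraph.fromRel fun i j => 0 < σ i j).induce
      {i : Fin (n+2) | i ≠ Fin.last (n+1)}).Connected)
    (E : ℝ) (hE : 0 < E) (V : Fin (n+2) → ℝ) (hV : Junction σ V)
    (h0 : V 0 = E) (hn : V (Fin.last (n+1)) = 0) :
    ∀ i : Fin (n+2), i ≠ 0 → i ≠ Fin.last (n+1) → 0 < V i ∧ V i < E := by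
  intro i hi0 hin
  constructor
  · have hbal : ∀ k, k ≠ Fin.last (n+1) → k ≠ 0 → ∑ j, σ k j * ((-V) k - (-V) j) = 0 := by
      intro k hkn hk0
      rw [← neg_eq_zero, ← Finset.sum_neg_distrib, ← hV k hk0 hkn]
      exact Finset.sum_congr rfl fun j _ => by simp only [Pi.neg_apply]; ring
    have := lt_of_balanced_of_connected hσ.1 hσ.2.1 hbal (by simp [h0, hn, hE]) hcn hin
    simpa [hn] using this
  · exact h0 ▸ lt_of_balanced_of_connected hσ.1 hσ.2.1 hV (by rw [h0, hn]; exact hE) hc0 hi0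
end

section
/- Let σ be a conductance matrix on n ≥ 2 nodes with det Σ''(σ) ≠ 0, and let ℰ : ℝ. Then there exists exactly one potential V : Fin n → ℝ satisfying the junction rules for σ together with the boundary conditions V 0 = ℰ and V (n-1) = 0. -/
open Matrix BigOperators

/-- Multiplying by the Laplacian gives the total current out of each node. -/
theorem lap_mulVec_apply {N : ℕ} {σ : Matrix (Fin N) (Fin N) ℝ} (hσ : ∀ i, σ i i = 0)
    (V : Fin N → ℝ) (i : Fin N) :
    (lap σ *ᵥ V) i = ∑ j, σ i j * (V i - V j) := by
  have hterm : ∀ j, lap σ i j * V j = (if i = j then (∑ k, σ i k) * V i else 0) - σ i j * V j := by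
    intro j
    by_cases h : i = j
    · subst h
      simp [lap, hσ]
    · simp [lap, h]
  simp only [mulVec, dotProduct, hterm, mul_sub, Finset.sum_sub_distrib, Finset.sum_ite_eq,
    Finset.mem_univ, if_true, Finset.sum_mul]

/-- The junction rules as a linear system for the interior potentials. -/
theorem junction_iff_sigmaPP_mulVec {n : ℕ} {σ : Matrix (Fin (n+2)) (Fin (n+2)) ℝ}
    (hσ : ∀ i, σ i i = 0) (V : Fin (n+2) → ℝ) :
    Junction σ V ↔ sigmaPP σ *ᵥ (fun i => V i.succ.castSucc) = fun i =>
      -(lap σ i.succ.castSucc 0 * V 0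
        + lap σ i.succ.castSucc (Fin.last (n+1)) * V (Fin.last (n+1))) := by
  have hrow : ∀ i : Fin n, ∑ j, σ i.succ.castSucc j * (V i.succ.castSucc - V j)
      = lap σ i.succ.castSucc 0 * V 0 + (sigmaPP σ *ᵥ fun i => V i.succ.castSucc) i
        + lap σ i.succ.castSucc (Fin.last (n+1)) * V (Fin.last (n+1)) := by
    intro i
    rw [← lap_mulVec_apply hσ]
    simp only [mulVec, dotProduct, sigmaPP, submatrix_apply]
    rw [Fin.sum_univ_castSucc, Fin.sum_univ_succ, Fin.castSucc_zero]
  constructor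
  · intro h
    funext i
    have hi := h i.succ.castSucc (by simp [Fin.ext_iff]) (Fin.castSucc_ne_last _)
    rw [hrow] at hi
    linarith
  · intro h i hi₀ hi₁
    obtain ⟨j, rfl⟩ := Fin.exists_castSucc_eq.2 hi₁
    obtain ⟨k, rfl⟩ := Fin.exists_succ_eq.2 (fun hj : j = 0 => hi₀ (by simp [hj]))
    rw [hrow, h]
    ring

/-- When `det Σ'' ≠ 0` there is a unique potential satisfying the junction rules with the
given boundary conditions. -/
theorem exists_unique_potential {n : ℕ} (σ : Matrix (Fin (n+2)) (Fin (n+2)) ℝ)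
    (hσ : IsConductance σ) (hdet : (sigmaPP σ).det ≠ 0) (E : ℝ) :
    ∃! V : Fin (n+2) → ℝ, Junction σ V ∧ V 0 = E ∧ V (Fin.last (n+1)) = 0 := by
  have hunit : IsUnit (sigmaPP σ) := (isUnit_iff_isUnit_det _).2 (isUnit_iff_ne_zero.2 hdet)
  obtain ⟨x, hx⟩ := mulVec_surjective_iff_isUnit.2 hunit
    (fun i => -(lap σ i.succ.castSucc 0 * E))
  refine ⟨Fin.snoc (α := fun _ => ℝ) (Fin.cons (α := fun _ => ℝ) E x) 0, ⟨?_, ?_, ?_⟩, ?_⟩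
  · rw [junction_iff_sigmaPP_mulVec hσ.2.2]
    simpa [-Fin.castSucc_succ] using hx
  · simp
  · simp
  · rintro W ⟨hW, hW₀, hW₁⟩
    rw [junction_iff_sigmaPP_mulVec hσ.2.2] at hW
    have hWx : (fun i : Fin n => W i.succ.castSucc) = x := by
      apply mulVec_injective_iff_isUnit.2 hunit
      rw [hx, hW, hW₀, hW₁]
      simp
    funext i
    refine Fin.lastCases ?_ (fun j => ?_) i
    · simp [hW₁]
    · refine Fin.cases ?_ (fun k => ?_) j
      · rw [Fin.snoc_castSucc, Fin.cons_zero, Fin.castSucc_zero, hW₀]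
      · simpa only [Fin.snoc_castSucc, Fin.cons_succ] using congrFun hWx k
end

section
/- Let σ be a conductance matrix on n ≥ 2 nodes, let ℰ : ℝ, and let V : Fin n → ℝ satisfy the junction rules for σ with V 0 = ℰ and V (n-1) = 0. Then the output current I_out = ∑_{j} σ 0 j * (V 0 - V j) satisfies I_out * det Σ''(σ) = ℰ * det Σ'(σ). In particular, when det Σ''(σ) ≠ 0 the equivalent conductance σ_eq = I_out / ℰ equals det Σ'(σ) / det Σ''(σ). -/
open Matrix BigOperators

/-- When the last node is grounded, `Σ'` maps the remaining potentials to the net currents. -/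
theorem sigmaP_mulVec_apply {n : ℕ} {σ : Matrix (Fin (n+2)) (Fin (n+2)) ℝ}
    (hσ : ∀ i, σ i i = 0) {V : Fin (n+2) → ℝ} (hn : V (Fin.last (n+1)) = 0)
    (i : Fin (n+1)) :
    (sigmaP σ *ᵥ fun j => V j.castSucc) i =
      ∑ j, σ i.castSucc j * (V i.castSucc - V j) := by
  rw [← lap_mulVec_apply hσ]
  simp [mulVec, dotProduct, sigmaP, Fin.sum_univ_castSucc (n := n + 1), hn]

/-- The top-left cofactor of `Σ'` is `det Σ''`. -/
theorem adjugate_sigmaP_zero_zero {n : ℕ} (σ : Matrix (Fin (n+2)) (Fin (n+2)) ℝ) :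
    (sigmaP σ).adjugate 0 0 = (sigmaPP σ).det := by
  rw [adjugate_fin_succ_eq_det_submatrix]
  simp [sigmaP, sigmaPP, Function.comp_def]

/-- The output current satisfies `I_out · det Σ'' = ℰ · det Σ'`; in particular when
`det Σ'' ≠ 0` the equivalent conductance `I_out / ℰ` equals `det Σ' / det Σ''`. -/
theorem equivalent_conductance_formula {n : ℕ} (σ : Matrix (Fin (n+2)) (Fin (n+2)) ℝ)
    (hσ : IsConductance σ) (E : ℝ) (V : Fin (n+2) → ℝ) (hV : Junction σ V)
    (h0 : V 0 = E) (hn : V (Fin.last (n+1)) = 0) :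
    (∑ j, σ 0 j * (V 0 - V j)) * (sigmaPP σ).det = E * (sigmaP σ).det ∧
    ((sigmaPP σ).det ≠ 0 → E ≠ 0 →
      (∑ j, σ 0 j * (V 0 - V j)) / E = (sigmaP σ).det / (sigmaPP σ).det) := by
  have hcur : (sigmaP σ *ᵥ fun j => V j.castSucc) =
      Pi.single 0 (∑ j, σ 0 j * (V 0 - V j)) := by
    ext i
    rw [sigmaP_mulVec_apply hσ.2.2 hn]
    by_cases hi : i = 0
    · subst hi
      simp
    · rw [Pi.single_eq_of_ne hi]
      exact hV _ (by simpa using hi) (Fin.castSucc_lt_last i).ne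
  have key : (∑ j, σ 0 j * (V 0 - V j)) * (sigmaPP σ).det = E * (sigmaP σ).det := by
    have h := congrFun (congrArg (fun w => (sigmaP σ).adjugate *ᵥ w) hcur) 0
    simp only [mulVec_mulVec, adjugate_mul, smul_mulVec, one_mulVec, Pi.smul_apply,
      Fin.castSucc_zero, h0, smul_eq_mul, mulVec_single, adjugate_sigmaP_zero_zero,
      col_apply, op_smul_eq_mul] at h
    rw [h0]
    linarith
  refine ⟨key, fun hdet hE => ?_⟩
  rw [div_eq_div_iff hE hdet, key, mul_comm]
end

section
/- Fix n ≥ 2 and consider the multivariate polynomial ring over ℤ with one variable X_{i,j} for each unordered pair {i,j} of distinct elements of Fin n. Let M be the (n-1)×(n-1) matrix over this ring, indexed by the nodes 0,…,n-2, with diagonal entries M i i = ∑_{j ≠ i} X_{i,j} (the sum over all n-1 other nodes j of Fin n, including node n-1) and off-diagonal entries M i j = -X_{i,j}. Then every coefficient of the polynomial det M is nonnegative. -/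
open Matrix BigOperators MvPolynomial

/-- If `A` is entrywise nonnegative with row sums at most one, then `det (1 - A)` is nonnegative. -/
theorem Matrix.det_one_sub_nonneg_of_sum_row_le_one {ι : Type*} [Fintype ι] [DecidableEq ι]
    (A : Matrix ι ι ℝ) (hA : ∀ i j, 0 ≤ A i j) (hsum : ∀ i, ∑ j, A i j ≤ 1) :
    0 ≤ (1 - A).det := by
  by_contra! hneg
  have hcont : Continuous fun t : ℝ => (1 - t • A).det := by fun_prop
  obtain ⟨t, ⟨ht0, ht1⟩, ht⟩ := intermediate_value_Icc' zero_le_one hcont.continuousOn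
    (show (0 : ℝ) ∈ Set.Icc _ _ by simpa using hneg.le)
  have htlt : t < 1 := ht1.lt_of_ne (by rintro rfl; simp_all)
  refine det_ne_zero_of_sum_row_lt_diag (A := 1 - t • A) (fun i => ?_) ht
  have hoff : ∑ j ∈ Finset.univ.erase i, ‖(1 - t • A) i j‖
      = ∑ j ∈ Finset.univ.erase i, t * A i j := by
    refine Finset.sum_congr rfl fun j hj => ?_
    simp [Matrix.one_apply_ne (Finset.ne_of_mem_erase hj).symm, abs_of_nonneg ht0,
      abs_of_nonneg (hA i j)]
  have hsplit := Finset.add_sum_erase Finset.univ (fun j => A i j) (Finset.mem_univ i)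
  have hdiag : (1 - t • A) i i ≤ ‖(1 - t • A) i i‖ := le_abs_self _
  rw [hoff, ← Finset.mul_sum]
  simp only [Matrix.sub_apply, Matrix.one_apply_eq, Matrix.smul_apply, smul_eq_mul] at hdiag ⊢
  nlinarith [hsum i]

/-- Row `i` of the matrix is `e i - e (f i)`, where the basis vector of the last node is zero. -/
theorem det_incidence_nonneg {n : ℕ} (f : Fin n → Fin (n + 1)) :
    0 ≤ (Matrix.of fun i j : Fin n =>
      (if i = j then (1 : ℤ) else 0) - if f i = j.castSucc then 1 else 0).det := by
  have h := Matrix.det_one_sub_nonneg_of_sum_row_le_one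
    (Matrix.of fun i j : Fin n => if f i = j.castSucc then (1 : ℝ) else 0)
    (fun i j => by simp only [Matrix.of_apply]; split_ifs <;> simp)
    (fun i => by
      have := Fin.sum_univ_castSucc fun k : Fin (n + 1) => if f i = k then (1 : ℝ) else 0
      rw [Finset.sum_ite_eq] at this
      simp only [Finset.mem_univ, if_true] at this
      simp only [Matrix.of_apply]
      split_ifs at this <;> linarith)
  rw [← Int.cast_nonneg_iff (R := ℝ), Int.cast_det]
  refine h.trans_eq (congrArg Matrix.det ?_)
  ext i j
  simp [Matrix.one_apply]

/-- Every coefficient of the determinant of the symbolic matrix Σ' (the weighted Laplacian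
of a circuit on `n+2` nodes with the row and column of the last node deleted, with a
polynomial variable `X s(i,j)` for each unordered pair of distinct nodes) is nonnegative. -/
theorem det_sigmaP_coeff_nonneg (n : ℕ) :
    ∀ c : Sym2 (Fin (n+2)) →₀ ℕ,
      0 ≤ MvPolynomial.coeff c
        (Matrix.det (Matrix.of fun i j : Fin (n+1) =>
          if i = j then
            ∑ k ∈ Finset.univ.filter (fun k : Fin (n+2) => k ≠ i.castSucc),
              (MvPolynomial.X s(i.castSucc, k) : MvPolynomial (Sym2 (Fin (n+2))) ℤ)
          else - MvPolynomial.X s(i.castSucc, j.castSucc))) := by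
  intro c
  let u : Fin (n + 1) → Fin (n + 2) → Fin (n + 1) → ℤ := fun i k j =>
    (if i = j then 1 else 0) - if k = j.castSucc then 1 else 0
  let w : Fin (n + 1) → Fin (n + 2) → MvPolynomial (Sym2 (Fin (n + 2))) ℤ := fun i k =>
    X s(i.castSucc, k)
  have hrows : (Matrix.of fun i j : Fin (n+1) =>
      if i = j then
        ∑ k ∈ Finset.univ.filter (fun k : Fin (n+2) => k ≠ i.castSucc),
          (MvPolynomial.X s(i.castSucc, k) : MvPolynomial (Sym2 (Fin (n+2))) ℤ)
      else - MvPolynomial.X s(i.castSucc, j.castSucc)) =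
      fun i => ∑ k, w i k • fun j => C (u i k j) := by
    ext1 i j
    rw [Finset.sum_apply]
    simp only [Matrix.of_apply, Pi.smul_apply, smul_eq_mul, u, w]
    split_ifs with hij
    · subst hij
      rw [Finset.sum_filter]
      refine Finset.sum_congr rfl fun k _ => ?_
      by_cases hk : k = i.castSucc <;> simp [hk]
    · simp
  have hdet (f : Fin (n + 1) → Fin (n + 2)) :
      detRowAlternating (fun i => w i (f i) • fun j => C (u i (f i) j)) =
        monomial (∑ i, Finsupp.single s(i.castSucc, f i) 1)
          (Matrix.of fun i j => u i (f i) j).det := by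
    have hC : detRowAlternating (fun i j => C (u i (f i) j)) =
        (C (Matrix.of fun i j => u i (f i) j).det : MvPolynomial (Sym2 (Fin (n + 2))) ℤ) :=
      (RingHom.map_det C _).symm
    have hw : ∏ i, w i (f i) = monomial (∑ i, Finsupp.single s(i.castSucc, f i) 1) 1 :=
      (monomial_sum_one _ _).symm
    rw [← AlternatingMap.coe_multilinearMap, MultilinearMap.map_smul_univ,
      AlternatingMap.coe_multilinearMap, hC, hw, smul_eq_mul, mul_comm, C_mul_monomial, mul_one]
  rw [hrows]
  change 0 ≤ coeff c (detRowAlternating.toMultilinearMap _)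
  rw [MultilinearMap.map_sum, coeff_sum]
  refine Finset.sum_nonneg fun f _ => ?_
  rw [AlternatingMap.coe_multilinearMap, hdet, coeff_monomial]
  split_ifs
  · exact det_incidence_nonneg f
  · exact le_rfl
end

section
/- Fix n ≥ 3 and consider the multivariate polynomial ring over ℤ with one variable X_{i,j} for each unordered pair {i,j} of distinct elements of Fin n. Let M be the (n-2)×(n-2) matrix over this ring, indexed by the interior nodes 1,…,n-2, with diagonal entries M i i = ∑_{j ≠ i} X_{i,j} (the sum over all n-1 other nodes j of Fin n, including nodes 0 and n-1) and off-diagonal entries M i j = -X_{i,j}. Then every coefficient of the polynomial det M is nonnegative. -/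
open Matrix BigOperators MvPolynomial

/-- If `P` is a substochastic real matrix, then `det (1 - P)` is nonnegative. -/
theorem det_one_sub_nonneg_of_substochastic {ι : Type*} [Fintype ι] [DecidableEq ι]
    (P : Matrix ι ι ℝ) (hP : ∀ i j, 0 ≤ P i j) (hsum : ∀ i, ∑ j, P i j ≤ 1) :
    0 ≤ (1 - P).det := by
  by_contra! hneg
  have hcont : Continuous fun t : ℝ => (1 - t • P).det := by fun_prop
  obtain ⟨t, ⟨ht0, ht1⟩, ht⟩ :=
    intermediate_value_Icc' zero_le_one hcont.continuousOn
      (show (0 : ℝ) ∈ Set.Icc ((1 - (1 : ℝ) • P).det) ((1 - (0 : ℝ) • P).det) by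
        simpa using hneg.le)
  have hlt : t < 1 := by
    refine lt_of_le_of_ne ht1 ?_
    rintro rfl
    simp only [one_smul] at ht
    exact hneg.ne ht
  refine det_ne_zero_of_sum_row_lt_diag (A := 1 - t • P) (fun i => ?_) ht
  have hoff : ∑ j ∈ Finset.univ.erase i, ‖(1 - t • P) i j‖ =
      t * ∑ j ∈ Finset.univ.erase i, P i j := by
    rw [Finset.mul_sum]
    refine Finset.sum_congr rfl fun j hj => ?_
    have hij : i ≠ j := (Finset.ne_of_mem_erase hj).symm
    simp [Matrix.one_apply_ne hij, abs_of_nonneg, ht0, hP i j]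
  have hsplit := Finset.add_sum_erase Finset.univ (P i) (Finset.mem_univ i)
  have hrow : t * ∑ j, P i j ≤ t := mul_le_of_le_one_right ht0 (hsum i)
  rw [← hsplit, mul_add] at hrow
  rw [hoff]
  refine lt_of_lt_of_le ?_ (le_abs_self _)
  simp only [Matrix.sub_apply, one_apply_eq, Matrix.smul_apply, smul_eq_mul]
  linarith

/-- The Laplacian-type determinant attached to a partial function: row `i` is `eᵢ - eₖ` when
`f i = e k`, and `eᵢ` when `f i` is outside the range of `e`. -/
theorem det_partial_function_laplacian_nonneg {ι κ : Type*} [Fintype ι] [DecidableEq ι]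
    [DecidableEq κ] {e : ι → κ} (he : Function.Injective e) (f : ι → κ) :
    0 ≤ (Matrix.of fun i j : ι =>
      (if i = j then 1 else 0) - (if f i = e j then 1 else 0) : Matrix ι ι ℤ).det := by
  rw [← Int.cast_nonneg_iff (R := ℝ), Int.cast_det]
  have hnonneg := det_one_sub_nonneg_of_substochastic
    (Matrix.of fun i j : ι => if f i = e j then (1 : ℝ) else 0)
    (fun i j => by simp only [of_apply]; split_ifs <;> norm_num)
    (fun i => by
      simp only [of_apply, Finset.sum_boole]
      norm_cast
      refine Finset.card_le_one.2 fun a ha b hb => he ?_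
      rw [← (Finset.mem_filter.1 ha).2, ← (Finset.mem_filter.1 hb).2])
  refine hnonneg.trans_eq (congrArg det (Matrix.ext fun i j => ?_))
  simp [Matrix.one_apply]

/-- Expansion of a grounded Laplacian determinant over all functions from interior nodes
to nodes. -/
theorem det_laplacian_eq_sum {R ι κ : Type*} [CommRing R] [Fintype ι] [DecidableEq ι]
    [Fintype κ] [DecidableEq κ] (e : ι → κ) (w : ι → κ → R) :
    (Matrix.of fun i j : ι =>
      ∑ k, w i k * ((if i = j then 1 else 0) - (if k = e j then 1 else 0))).det =
    ∑ f : ι → κ, (∏ i, w i (f i)) *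
      (((Matrix.of fun i j : ι =>
        (if i = j then 1 else 0) - (if f i = e j then 1 else 0) : Matrix ι ι ℤ).det : ℤ) : R) := by
  have hrows := (detRowAlternating (R := R) (n := ι)).toMultilinearMap.map_sum
    (fun i k (j : ι) => w i k * ((if i = j then 1 else 0) - (if k = e j then 1 else 0)))
  convert hrows using 1
  · change det _ = det _
    congr 1
    ext i j
    simp
  · refine Finset.sum_congr rfl fun f _ => ?_
    rw [Int.cast_det, ← det_mul_column]
    change det _ = det _
    congr 1
    ext i j
    simp

theorem MvPolynomial.coeff_prod_X_nonneg {σ ι : Type*} (s : Finset ι) (g : ι → σ)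
    (c : σ →₀ ℕ) : 0 ≤ coeff c (∏ i ∈ s, (X (g i) : MvPolynomial σ ℤ)) := by
  classical
  have hmon : ∏ i ∈ s, (X (g i) : MvPolynomial σ ℤ) =
      monomial (∑ i ∈ s, Finsupp.single (g i) 1) 1 := by
    rw [monomial_sum_one]
    rfl
  rw [hmon, coeff_monomial]
  split_ifs <;> norm_num

/-- Every coefficient of the determinant of the symbolic matrix Σ'' (the weighted Laplacian
of a circuit on `n+3` nodes with the rows and columns of the first and last nodes deleted,
with a polynomial variable `X s(i,j)` for each unordered pair of distinct nodes) is
nonnegative. -/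
theorem det_sigmaPP_coeff_nonneg (n : ℕ) :
    ∀ c : Sym2 (Fin (n+3)) →₀ ℕ,
      0 ≤ MvPolynomial.coeff c
        (Matrix.det (Matrix.of fun i j : Fin (n+1) =>
          if i = j then
            ∑ k ∈ Finset.univ.filter (fun k : Fin (n+3) => k ≠ i.succ.castSucc),
              (MvPolynomial.X s(i.succ.castSucc, k) : MvPolynomial (Sym2 (Fin (n+3))) ℤ)
          else - MvPolynomial.X s(i.succ.castSucc, j.succ.castSucc))) := by
  intro c
  have hinj : Function.Injective fun i : Fin (n+1) => i.succ.castSucc :=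
    (Fin.castSucc_injective _).comp (Fin.succ_injective _)
  have hdet := det_laplacian_eq_sum (fun i : Fin (n+1) => i.succ.castSucc)
    (fun i k => (X s(i.succ.castSucc, k) : MvPolynomial (Sym2 (Fin (n+3))) ℤ))
  suffices hmat : (Matrix.of fun i j : Fin (n+1) =>
      if i = j then
        ∑ k ∈ Finset.univ.filter (fun k : Fin (n+3) => k ≠ i.succ.castSucc),
          (X s(i.succ.castSucc, k) : MvPolynomial (Sym2 (Fin (n+3))) ℤ)
      else - X s(i.succ.castSucc, j.succ.castSucc)) =
      Matrix.of fun i j : Fin (n+1) => ∑ k, X s(i.succ.castSucc, k) *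
        ((if i = j then 1 else 0) - (if k = j.succ.castSucc then 1 else 0)) by
    rw [hmat, hdet, coeff_sum]
    refine Finset.sum_nonneg fun f _ => ?_
    rw [← map_intCast (C : ℤ →+* MvPolynomial (Sym2 (Fin (n+3))) ℤ), mul_comm, coeff_C_mul]
    refine mul_nonneg ?_ (coeff_prod_X_nonneg _ _ _)
    simpa only [Int.cast_id] using det_partial_function_laplacian_nonneg hinj f
  refine Matrix.ext fun i j => ?_
  simp only [of_apply]
  split_ifs with hij
  · subst hij
    rw [Finset.sum_filter]
    refine Finset.sum_congr rfl fun k _ => ?_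
    by_cases hk : k = i.succ.castSucc
    · simp [hk]
    · rw [if_pos hk, if_neg hk, sub_zero, mul_one]
  · simp
end

section
/- Let σ be a conductance matrix on n ≥ 2 nodes whose associated graph is connected. Then det Σ'(σ) > 0 and det Σ''(σ) > 0. -/
open Matrix BigOperators

theorem dotProduct_lap_mulVec {N : ℕ} {σ : Matrix (Fin N) (Fin N) ℝ} (hσ : IsConductance σ)
    (y : Fin N → ℝ) :
    y ⬝ᵥ lap σ *ᵥ y = (∑ i, ∑ j, σ i j * (y i - y j) ^ 2) / 2 := by
  obtain ⟨hsymm, -, hdiag⟩ := hσ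
  have hlap (i j : Fin N) : lap σ i j = (if i = j then ∑ k, σ i k else 0) - σ i j := by
    by_cases h : i = j
    · subst h; simp [lap, hdiag]
    · simp [lap, h]
  have hrow (i : Fin N) : y i * (lap σ *ᵥ y) i = ∑ j, σ i j * (y i * (y i - y j)) := by
    simp only [mulVec, dotProduct, hlap, sub_mul, ite_mul, zero_mul, Finset.sum_sub_distrib,
      Finset.sum_ite_eq, Finset.mem_univ, if_true, Finset.sum_mul, mul_sub, Finset.mul_sum]
    congr 1 <;> exact Finset.sum_congr rfl fun _ _ => by ring
  have hswap : ∑ i, ∑ j, σ i j * (y i * (y i - y j)) =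
      ∑ i, ∑ j, σ i j * (y j * (y j - y i)) := by
    rw [Finset.sum_comm]
    exact Finset.sum_congr rfl fun i _ => Finset.sum_congr rfl fun j _ => by rw [hsymm j i]
  have hsum : ∑ i, ∑ j, σ i j * (y i - y j) ^ 2 =
      ∑ i, ∑ j, σ i j * (y i * (y i - y j)) + ∑ i, ∑ j, σ i j * (y j * (y j - y i)) := by
    simp only [← Finset.sum_add_distrib]
    exact Finset.sum_congr rfl fun i _ => Finset.sum_congr rfl fun j _ => by ring
  simp only [dotProduct, hrow]
  rw [hsum, ← hswap]
  ring

/-- On a connected circuit, a potential with zero energy is constant. -/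
theorem eq_of_dotProduct_lap_mulVec_nonpos {N : ℕ} {σ : Matrix (Fin N) (Fin N) ℝ}
    (hσ : IsConductance σ)
    (hconn : (SimpleGraph.fromRel fun i j : Fin N => 0 < σ i j).Connected)
    {y : Fin N → ℝ} (hy : y ⬝ᵥ lap σ *ᵥ y ≤ 0) (u v : Fin N) : y u = y v := by
  rw [dotProduct_lap_mulVec hσ] at hy
  have hterm (i j : Fin N) : 0 ≤ σ i j * (y i - y j) ^ 2 :=
    mul_nonneg (hσ.2.1 i j) (sq_nonneg _)
  have hedge (i j : Fin N) (hij : 0 < σ i j) : y i = y j := by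
    have hle : σ i j * (y i - y j) ^ 2 ≤ ∑ i, ∑ j, σ i j * (y i - y j) ^ 2 :=
      (Finset.single_le_sum (fun k _ => hterm i k) (Finset.mem_univ j)).trans
        (Finset.single_le_sum (f := fun i => ∑ j, σ i j * (y i - y j) ^ 2)
          (fun k _ => Finset.sum_nonneg fun l _ => hterm k l) (Finset.mem_univ i))
    have hzero : σ i j * (y i - y j) ^ 2 = 0 := le_antisymm (by linarith) (hterm i j)
    exact sub_eq_zero.mp (pow_eq_zero_iff two_ne_zero |>.mp
      ((mul_eq_zero.mp hzero).resolve_left hij.ne'))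
  obtain ⟨p⟩ := hconn.preconnected u v
  induction p with
  | nil => rfl
  | cons hadj _ ih =>
    refine Eq.trans ?_ ih
    rcases ((SimpleGraph.fromRel_adj _ _ _).mp hadj).2 with h | h
    · exact hedge _ _ h
    · exact (hedge _ _ h).symm

/-- A principal submatrix of the Laplacian of a connected circuit that omits at least one node is
positive definite. -/
theorem posDef_lap_submatrix {ι : Type*} [Fintype ι] {N : ℕ} {σ : Matrix (Fin N) (Fin N) ℝ}
    (hσ : IsConductance σ)
    (hconn : (SimpleGraph.fromRel fun i j : Fin N => 0 < σ i j).Connected)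
    {f : ι → Fin N} (hf : Function.Injective f) {v : Fin N} (hv : v ∉ Set.range f) :
    ((lap σ).submatrix f f).PosDef := by
  refine PosDef.of_dotProduct_mulVec_pos ?_ fun x hx => ?_
  · ext i j
    by_cases h : f i = f j
    · simp [lap, h]
    · simp [lap, h, Ne.symm h, hσ.1 (f i) (f j)]
  · set y : Fin N → ℝ := Function.extend f x 0
    have hyf (i : ι) : y (f i) = x i := hf.extend_apply x 0 i
    have hy0 (k : Fin N) (hk : k ∉ Set.range f) : y k = 0 :=
      Function.extend_apply' x (0 : Fin N → ℝ) k hk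
    have hform : star x ⬝ᵥ (lap σ).submatrix f f *ᵥ x = y ⬝ᵥ lap σ *ᵥ y := by
      refine Fintype.sum_of_injective f hf _ _ (fun k hk => by simp [hy0 k hk]) fun i => ?_
      have hrow : ((lap σ).submatrix f f *ᵥ x) i = (lap σ *ᵥ y) (f i) :=
        Fintype.sum_of_injective f hf _ _ (fun k hk => by simp [hy0 k hk]) fun j => by simp [hyf]
      simp [hyf, hrow]
    rw [hform]
    by_contra hneg
    refine hx (funext fun i => ?_)
    rw [← hyf, eq_of_dotProduct_lap_mulVec_nonpos hσ hconn (not_lt.mp hneg) (f i) v, hy0 v hv]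
    rfl

/-- For a connected circuit, both `det Σ'` and `det Σ''` are strictly positive. -/
theorem det_pos_of_connected {n : ℕ} (σ : Matrix (Fin (n+2)) (Fin (n+2)) ℝ)
    (hσ : IsConductance σ)
    (hconn : (SimpleGraph.fromRel fun i j : Fin (n+2) => 0 < σ i j).Connected) :
    0 < (sigmaP σ).det ∧ 0 < (sigmaPP σ).det := by
  have hlast : Fin.last (n + 1) ∉ Set.range (Fin.castSucc : Fin (n + 1) → Fin (n + 2)) := by
    rintro ⟨i, hi⟩
    exact Fin.castSucc_ne_last i hi
  exact ⟨(posDef_lap_submatrix hσ hconn (Fin.castSucc_injective _) hlast).det_pos,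
    (posDef_lap_submatrix hσ hconn
      ((Fin.castSucc_injective _).comp (Fin.succ_injective _))
      fun h => hlast (Set.range_comp_subset_range _ _ h)).det_pos⟩
end

section
/- Let σ be a conductance matrix on n ≥ 3 nodes and let m be an interior node (m ≠ 0, m ≠ n-1) having exactly one possible neighbor l ≠ m, i.e. σ m j = 0 for every j ∉ {l, m}. Let σ̃ be the conductance matrix on the n-1 nodes obtained by deleting node m (all other entries unchanged). Then det Σ'(σ) = σ m l · det Σ'(σ̃) and det Σ''(σ) = σ m l · det Σ''(σ̃). In particular, when det Σ''(σ̃) ≠ 0 and σ m l ≠ 0, the equivalent conductance det Σ'(σ)/det Σ''(σ) does not depend on σ m l. -/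
open Matrix BigOperators

/-- Deleting a node whose only possible neighbor is `l` from a principal submatrix of the
Laplacian containing that node divides the determinant by `σ m l`. The retained nodes are
selected by `e` before the deletion and by `f` after it. -/
theorem det_lap_submatrix_of_dangling {N k : ℕ} {σ : Matrix (Fin (N+1)) (Fin (N+1)) ℝ}
    (hσ : IsConductance σ) {m l : Fin (N+1)} (hlm : l ≠ m)
    (hdeg : ∀ j, j ≠ l → j ≠ m → σ m j = 0)
    (e : Fin (k+1) → Fin (N+1)) (f : Fin k → Fin N) (hf : Function.Injective f)
    (p : Fin (k+1)) (hp : e p = m) (hef : ∀ i, e (p.succAbove i) = m.succAbove (f i)) :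
    ((lap σ).submatrix e e).det =
      σ m l * ((lap (σ.submatrix m.succAbove m.succAbove)).submatrix f f).det := by
  obtain ⟨hsymm, -, hdiag⟩ := hσ
  have hrow : ∑ j, σ m j = σ m l :=
    Finset.sum_eq_single l
      (fun j _ hj => if h : j = m then h ▸ hdiag j else hdeg j hj h) (by simp)
  let c : Fin (k+1) → ℝ := fun i => if e i = l then 1 else 0
  have hcp : c p = 0 := if_neg (hp ▸ hlm.symm)
  have hc : ∀ i, c (p.succAbove i) * σ m l = σ m (m.succAbove (f i)) := by
    intro i
    by_cases h : m.succAbove (f i) = l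
    · simp [c, hef, h]
    · simp [c, hef, h, hdeg _ h (Fin.succAbove_ne m _)]
  -- Adding `c i` times row `p` to row `i` clears column `p` off the diagonal.
  let A : Matrix (Fin (k+1)) (Fin (k+1)) ℝ :=
    Matrix.of fun i j => lap σ (e i) (e j) + c i * lap σ (e p) (e j)
  have hdet : A.det = ((lap σ).submatrix e e).det :=
    Matrix.det_eq_of_forall_row_eq_smul_add_const c p hcp (fun _ _ => rfl)
  have hpp : A p p = σ m l := by simp [A, hcp, hp, lap, hrow]
  have hcol : ∀ i, A (p.succAbove i) p = 0 := by
    intro i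
    simp [A, hef, hp, lap, hrow, hc, Fin.succAbove_ne, hsymm _ m]
  have hminor : A.submatrix p.succAbove p.succAbove =
      (lap (σ.submatrix m.succAbove m.succAbove)).submatrix f f := by
    ext i j
    have hmj : lap σ m (m.succAbove (f j)) = -σ m (m.succAbove (f j)) := by
      simp [lap, (Fin.succAbove_ne m (f j)).symm]
    by_cases hij : i = j
    · subst hij
      have hsq : c (p.succAbove i) * σ m (m.succAbove (f i)) = σ m (m.succAbove (f i)) := by
        rw [← hc i]
        simp only [c]
        split_ifs <;> simp
      simp only [A, Matrix.submatrix_apply, Matrix.of_apply, hef, hp, hmj, mul_neg, hsq]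
      simp [lap, Fin.sum_univ_succAbove _ m, hsymm _ m]
    · have hzero : c (p.succAbove i) * σ m (m.succAbove (f j)) = 0 := by
        by_cases h : m.succAbove (f i) = l
        · have hj : m.succAbove (f j) ≠ l := fun hj =>
            hij (hf (Fin.succAbove_right_injective (h.trans hj.symm)))
          simp [hdeg _ hj (Fin.succAbove_ne m _)]
        · simp [c, hef, h]
      simp only [A, Matrix.submatrix_apply, Matrix.of_apply, hef, hp, hmj, mul_neg, hzero]
      simp [lap, hf.eq_iff, hij]
  rw [← hdet, Matrix.det_succ_column A p, Fin.sum_univ_succAbove _ p]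
  simp [hcol, hpp, hminor]

/-- Dangling-edge reduction: if the interior node `m` has `l` as its only possible
neighbor, then deleting node `m` divides both `det Σ'` and `det Σ''` by `σ m l`;
hence the equivalent conductance does not depend on `σ m l`. -/
theorem dangling_edge_reduction {n : ℕ} (σ : Matrix (Fin (n+3)) (Fin (n+3)) ℝ)
    (hσ : IsConductance σ) (m l : Fin (n+3))
    (hm0 : m ≠ 0) (hmn : m ≠ Fin.last (n+2)) (hlm : l ≠ m)
    (hdeg : ∀ j, j ≠ l → j ≠ m → σ m j = 0) :
    let σt : Matrix (Fin (n+2)) (Fin (n+2)) ℝ := σ.submatrix m.succAbove m.succAbove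
    (sigmaP σ).det = σ m l * (sigmaP σt).det ∧
    (sigmaPP σ).det = σ m l * (sigmaPP σt).det ∧
    ((sigmaPP σt).det ≠ 0 → σ m l ≠ 0 →
      (sigmaP σ).det / (sigmaPP σ).det = (sigmaP σt).det / (sigmaPP σt).det) := by
  intro σt
  have hP : (sigmaP σ).det = σ m l * (sigmaP σt).det := by
    obtain ⟨p, rfl⟩ := Fin.exists_castSucc_eq.mpr hmn
    exact det_lap_submatrix_of_dangling hσ hlm hdeg _ _ (Fin.castSucc_injective _) p rfl
      fun i => by simp
  have hPP : (sigmaPP σ).det = σ m l * (sigmaPP σt).det := by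
    obtain ⟨q, rfl⟩ := Fin.exists_castSucc_eq.mpr hmn
    obtain ⟨p, rfl⟩ := Fin.exists_succ_eq.mpr (show q ≠ 0 from fun h => hm0 (by simp [h]))
    exact det_lap_submatrix_of_dangling hσ hlm hdeg _ _
      ((Fin.castSucc_injective _).comp (Fin.succ_injective _)) p rfl fun i => by simp
  exact ⟨hP, hPP, fun _ hs => by rw [hP, hPP, mul_div_mul_left _ _ hs]⟩
end

section
/- Let σ be a conductance matrix on n ≥ 4 nodes, let k be an interior node (k ≠ 0, k ≠ n-1) connected in series: there exist distinct nodes l, m, both different from k, with σ k j = 0 for every j ∉ {l, m}, with σ k l + σ k m > 0, and with σ l m = 0. Let σ̃ be the conductance matrix on the n-1 nodes obtained by deleting node k and setting the new edge conductance between l and m to σ̃ l m = (σ k l · σ k m)/(σ k l + σ k m), all other entries unchanged. Then det Σ'(σ) = (σ k l + σ k m) · det Σ'(σ̃) and det Σ''(σ) = (σ k l + σ k m) · det Σ''(σ̃). -/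
open Matrix BigOperators

/-- The determinant is a pivot entry times the determinant of its Schur complement. -/
theorem det_eq_pivot_mul_det_schur {K : Type*} [Field K] {N : ℕ}
    (A : Matrix (Fin (N+1)) (Fin (N+1)) K)
    (p : Fin (N+1)) (hp : A p p ≠ 0) :
    A.det = A p p * (Matrix.of fun i j : Fin N =>
      A (p.succAbove i) (p.succAbove j)
        - A (p.succAbove i) p * A p (p.succAbove j) / A p p).det := by
  let e : Unit ⊕ Fin N ≃ Fin (N+1) :=
    (Equiv.sumComm _ _).trans ((Equiv.optionEquivSumPUnit _).symm.trans (finSuccEquiv' p).symm)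
  have hl : ∀ u, e (Sum.inl u) = p := fun u => by simp [e]
  have hr : ∀ i, e (Sum.inr i) = p.succAbove i := fun i => by simp [e]
  let : Invertible (A.submatrix e e).toBlocks₁₁ :=
    Matrix.invertibleOfIsUnitDet _ (by simpa [Matrix.toBlocks₁₁, hl] using hp)
  rw [← Matrix.det_submatrix_equiv_self e A, ← Matrix.fromBlocks_toBlocks (A.submatrix e e),
    Matrix.det_fromBlocks₁₁]
  congr 1
  · simp [Matrix.toBlocks₁₁, hl]
  · congr 1
    ext i j
    rw [Matrix.invOf_eq_nonsing_inv]
    simp [Matrix.mul_apply, Matrix.toBlocks₁₁, Matrix.toBlocks₁₂, Matrix.toBlocks₂₁,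
      Matrix.toBlocks₂₂, hl, hr]
    ring

/-- The Laplacian of the series-reduced network is the Schur complement of the pivot `k`. -/
theorem lap_series_reduction {N : ℕ} (σ : Matrix (Fin (N+1)) (Fin (N+1)) ℝ)
    (hσ : IsConductance σ) (k l m : Fin (N+1))
    (hlm : l ≠ m)
    (hdeg : ∀ j, j ≠ l → j ≠ m → σ k j = 0)
    (hpos : 0 < σ k l + σ k m) (hser : σ l m = 0) (i j : Fin N) :
    lap (Matrix.of fun i j : Fin N =>
      if (k.succAbove i = l ∧ k.succAbove j = m) ∨ (k.succAbove i = m ∧ k.succAbove j = l)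
      then σ k l * σ k m / (σ k l + σ k m)
      else σ (k.succAbove i) (k.succAbove j)) i j =
    lap σ (k.succAbove i) (k.succAbove j)
      - lap σ (k.succAbove i) k * lap σ k (k.succAbove j) / lap σ k k := by
  obtain ⟨hsymm, -, hdiag⟩ := hσ
  have hdegree : ∑ j, σ k j = σ k l + σ k m :=
    Fintype.sum_eq_add l m hlm fun x hx => hdeg x hx.1 hx.2
  have hne := hpos.ne'
  have hentry : ∀ a b : Fin (N+1), (if (a = l ∧ b = m) ∨ (a = m ∧ b = l)
      then σ k l * σ k m / (σ k l + σ k m) else σ a b) =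
      σ a b + σ k a * σ k b / (σ k l + σ k m)
        - if b = a then σ k a * σ k a / (σ k l + σ k m) else 0 := by
    intro a b
    have hser' : σ m l = 0 := hsymm m l ▸ hser
    by_cases hab : b = a
    · subst hab
      have : ¬((b = l ∧ b = m) ∨ (b = m ∧ b = l)) := by
        rintro (⟨rfl, h⟩ | ⟨h, rfl⟩) <;> exact hlm h
      simp [this]
    · rw [if_neg hab]
      split_ifs with h
      · rcases h with ⟨rfl, rfl⟩ | ⟨rfl, rfl⟩
        · simp [hser]
        · simp [hser', mul_comm]
      · have : σ k a = 0 ∨ σ k b = 0 := by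
          by_contra! hc
          have ha := mt (fun h : a ≠ l ∧ a ≠ m => hdeg a h.1 h.2) hc.1
          have hb := mt (fun h : b ≠ l ∧ b ≠ m => hdeg b h.1 h.2) hc.2
          grind
        rcases this with h0 | h0 <;> simp [h0]
  have hrow : ∑ x, σ k (k.succAbove x) = σ k l + σ k m := by
    rw [← hdegree, Fin.sum_univ_succAbove _ k, hdiag, zero_add]
  simp only [lap, Matrix.of_apply, hentry, Fin.succAbove_right_inj, Fin.succAbove_ne,
    (Fin.succAbove_ne k _).symm, if_false, if_true, hdegree]
  rw [hsymm (k.succAbove i) k]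
  by_cases hij : i = j
  · subst hij
    simp only [if_true, Finset.sum_sub_distrib, Finset.sum_add_distrib, Finset.sum_ite_eq',
      Finset.mem_univ, ← Finset.sum_div, ← Finset.mul_sum, hrow]
    rw [Fin.sum_univ_succAbove _ k, hsymm (k.succAbove i) k]
    field_simp
    ring
  · simp only [if_neg hij, if_neg (Ne.symm hij)]
    ring

/-- Series reduction: if interior node `k` is only connected to `l` and `m` (which are not
directly connected), deleting `k` and replacing the two edges by a single edge of
conductance `σkl·σkm/(σkl+σkm)` multiplies both `det Σ'` and `det Σ''` by `σkl+σkm`. -/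
theorem series_reduction {n : ℕ} (σ : Matrix (Fin (n+4)) (Fin (n+4)) ℝ)
    (hσ : IsConductance σ) (k l m : Fin (n+4))
    (hk0 : k ≠ 0) (hkn : k ≠ Fin.last (n+3))
    (hlm : l ≠ m) (hlk : l ≠ k) (hmk : m ≠ k)
    (hdeg : ∀ j, j ≠ l → j ≠ m → σ k j = 0)
    (hpos : 0 < σ k l + σ k m) (hser : σ l m = 0) :
    let σt : Matrix (Fin (n+3)) (Fin (n+3)) ℝ := Matrix.of fun i j =>
      if (k.succAbove i = l ∧ k.succAbove j = m) ∨ (k.succAbove i = m ∧ k.succAbove j = l)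
      then σ k l * σ k m / (σ k l + σ k m)
      else σ (k.succAbove i) (k.succAbove j)
    (sigmaP σ).det = (σ k l + σ k m) * (sigmaP σt).det ∧
    (sigmaPP σ).det = (σ k l + σ k m) * (sigmaPP σt).det := by
  intro σt
  have hkk : lap σ k k = σ k l + σ k m := by
    simp only [lap, Matrix.of_apply, if_true]
    exact Fintype.sum_eq_add l m hlm fun x hx => hdeg x hx.1 hx.2
  have hschur := lap_series_reduction σ hσ k l m hlm hdeg hpos hser
  have hne := hpos.ne'
  obtain ⟨p, rfl⟩ := Fin.exists_castSucc_eq.2 hkn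
  constructor
  · rw [det_eq_pivot_mul_det_schur (sigmaP σ) p (by rwa [sigmaP, Matrix.submatrix_apply, hkk])]
    congr 1
    congr 1
    ext i j
    simp only [sigmaP, Matrix.of_apply, Matrix.submatrix_apply, σt, hschur,
      Fin.castSucc_succAbove_castSucc]
  · obtain ⟨q, rfl⟩ := Fin.exists_succ_eq.2 (show p ≠ 0 from fun h => hk0 (by simp [h]))
    rw [det_eq_pivot_mul_det_schur (sigmaPP σ) q (by rwa [sigmaPP, Matrix.submatrix_apply, hkk])]
    congr 1
    congr 1
    ext i j
    simp only [sigmaPP, Matrix.of_apply, Matrix.submatrix_apply, σt, hschur,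
      Fin.castSucc_succAbove_castSucc, Fin.succ_succAbove_succ]
end

section
/- Let σ be a conductance matrix on n ≥ 2 nodes and let π be a permutation of Fin n fixing the two battery nodes: π 0 = 0 and π (n-1) = n-1. Let σ^π be the relabeled conductance matrix, σ^π i j = σ (π i) (π j). Then det Σ'(σ^π) = det Σ'(σ) and det Σ''(σ^π) = det Σ''(σ); hence the equivalent conductance det Σ'/det Σ'' is invariant under relabeling of the nodes other than the two battery terminals. -/
open Matrix BigOperators

/-- The Laplacian commutes with relabeling of the nodes. -/
theorem lap_submatrix_perm {N : ℕ} (σ : Matrix (Fin N) (Fin N) ℝ) (π : Equiv.Perm (Fin N)) :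
    lap (σ.submatrix π π) = (lap σ).submatrix π π := by
  ext i j
  simp [lap, Equiv.sum_comp π (fun k => σ (π i) k)]

/-- A principal minor is unchanged by a simultaneous permutation of rows and columns that
preserves its index set. -/
theorem det_submatrix_submatrix_perm {m p R : Type*} [Fintype m] [DecidableEq m] [CommRing R]
    (A : Matrix p p R) (π : Equiv.Perm p) {f : m → p} (hf : Function.Injective f)
    (h : ∀ i, ∃ j, f j = π (f i)) :
    ((A.submatrix π π).submatrix f f).det = (A.submatrix f f).det := by
  choose g hg using h
  have hinj : Function.Injective g := fun a b hab =>
    hf (π.injective (by rw [← hg, ← hg, hab]))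
  let e : m ≃ m := Equiv.ofBijective g (Finite.injective_iff_bijective.mp hinj)
  rw [← Matrix.det_submatrix_equiv_self e (A.submatrix f f)]
  congr 1
  ext i j
  simp [e, hg]

/-- Relabeling the nodes other than the two battery terminals leaves `det Σ'`, `det Σ''`,
and hence the equivalent conductance, unchanged. -/
theorem relabel_invariance {n : ℕ} (σ : Matrix (Fin (n+2)) (Fin (n+2)) ℝ)
    (hσ : IsConductance σ) (π : Equiv.Perm (Fin (n+2)))
    (hπ0 : π 0 = 0) (hπn : π (Fin.last (n+1)) = Fin.last (n+1)) :
    let σπ : Matrix (Fin (n+2)) (Fin (n+2)) ℝ := Matrix.of fun i j => σ (π i) (π j)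
    (sigmaP σπ).det = (sigmaP σ).det ∧
    (sigmaPP σπ).det = (sigmaPP σ).det ∧
    (sigmaP σπ).det / (sigmaPP σπ).det = (sigmaP σ).det / (sigmaPP σ).det := by
  intro σπ
  have hlap : lap σπ = (lap σ).submatrix π π := lap_submatrix_perm σ π
  have hP : (sigmaP σπ).det = (sigmaP σ).det := by
    rw [sigmaP, hlap]
    refine det_submatrix_submatrix_perm _ π (Fin.castSucc_injective _) fun i => ?_
    refine Fin.exists_castSucc_eq.mpr fun h => i.castSucc_ne_last ?_
    exact π.injective (h.trans hπn.symm)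
  have hPP : (sigmaPP σπ).det = (sigmaPP σ).det := by
    rw [sigmaPP, hlap]
    refine det_submatrix_submatrix_perm _ π
      ((Fin.castSucc_injective _).comp (Fin.succ_injective _)) fun i => ?_
    obtain ⟨j, hj⟩ := Fin.exists_castSucc_eq.mpr fun h : π i.succ.castSucc = Fin.last (n+1) =>
      i.succ.castSucc_ne_last (π.injective (h.trans hπn.symm))
    have hj0 : j ≠ 0 := by
      rintro rfl
      have h0 : i.succ.castSucc = 0 := π.injective (hj.symm.trans hπ0.symm)
      exact i.succ_ne_zero (Fin.castSucc_injective _ h0)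
    obtain ⟨k, rfl⟩ := Fin.exists_succ_eq.mpr hj0
    exact ⟨k, hj⟩
  exact ⟨hP, hPP, by rw [hP, hPP]⟩
end
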